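/- Let N ≥ 1, let a be a real number with −1 < a < 1 and aN < 2, and let p > 1 + (2−a)/N. Let Γ : ℝ^N × ℝ^N × (0,∞) → ℝ be a measurable nonnegative kernel satisfying (K1), (K2), and the upper Gaussian-type bound: there exist C₀, c₀ > 0 such that Γ(x,y,t) ≤ C₀ t^{−N/(2−a)} exp(−c₀ (|x−y|^{(2−a)}/t)^{1/(1−a)}) for all x, y ∈ ℝ^N and t > 0. Then there exists δ > 0 such that for every measurable function φ on ℝ^N satisfying 0 ≤ φ(x) ≤ δ / (1 + |x|^{(2−a)/(p−1)}) for all x ∈ ℝ^N, there exists a global-in-time mild solution u of u_t = div(w∇u) + u^p with kernel Γ and initial data φ, and it satisfies sup_{t>0} (1+t)^{(N/(2−a))(1/r_* − 1/q)} ‖u(·,t)‖_{q,∞} < ∞ for every q with r_* ≤ q ≤ ∞, where r_* := N(p−1)/(2−a). -/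

import Mathlib

open MeasureTheory Real Set
open scoped ENNReal

noncomputable section

/-- `N`-dimensional Euclidean space. -/
abbrev E (N : ℕ) : Type := EuclideanSpace ℝ (Fin N)

/-- A mild solution of `u_t = div(w ∇u) + u^p` with kernel `Γ` and initial data `φ`
on `ℝ^N × (0,T)` (`T ∈ (0,∞]`): a nonnegative measurable function, essentially bounded
on `ℝ^N × (0,T)`, satisfying the Duhamel integral identity (with all integrals finite). -/
def IsMildSolution (N : ℕ) (p : ℝ) (Γ : E N → E N → ℝ → ℝ)
    (φ : E N → ℝ) (T : ℝ≥0∞) (u : E N → ℝ → ℝ) : Prop :=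
  Measurable (fun q : E N × ℝ => u q.1 q.2) ∧
  (∀ x t, 0 ≤ u x t) ∧
  (∃ M : ℝ, ∀ t : ℝ, 0 < t → ENNReal.ofReal t < T →
    ∀ᵐ x : E N ∂volume, u x t ≤ M) ∧
  (∀ t : ℝ, 0 < t → ENNReal.ofReal t < T →
    ∀ᵐ x : E N ∂volume,
      Integrable (fun y => Γ x y t * φ y) volume ∧
      Integrable (fun q : E N × ℝ => Γ x q.1 (t - q.2) * u q.1 q.2 ^ p)
        (volume.prod (volume.restrict (Ioo (0:ℝ) t))) ∧
      u x t = (∫ y, Γ x y t * φ y) +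
        ∫ s in Ioo (0:ℝ) t, ∫ y, Γ x y (t - s) * u y s ^ p)

/-- The weak `L^r` quasinorm `‖f‖_{r,∞} = sup_{λ>0} λ |{|f|>λ}|^{1/r}`. -/
def weakNorm (N : ℕ) (r : ℝ) (f : E N → ℝ) : ℝ≥0∞ :=
  ⨆ (l : ℝ) (_ : 0 < l), ENNReal.ofReal l * (volume {x : E N | l < |f x|}) ^ (1 / r)


/-- The action `∫ K(x,y,t) f(y) dy` of a time-dependent nonnegative kernel. -/
def kernelOp {α : Type*} [MeasureSpace α] (K : α → α → ℝ → ℝ≥0∞) (t : ℝ) (f : α → ℝ≥0∞)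
    (x : α) : ℝ≥0∞ :=
  ∫⁻ y, K x y t * f y

/-- The right-hand side of the Duhamel identity with power nonlinearity. -/
def duhamelMap {α : Type*} [MeasureSpace α] (K : α → α → ℝ → ℝ≥0∞) (p : ℝ) (f : α → ℝ≥0∞)
    (u : α → ℝ → ℝ≥0∞) (x : α) (t : ℝ) : ℝ≥0∞ :=
  kernelOp K t f x + ∫⁻ s in Ioo (0:ℝ) t, kernelOp K (t - s) (fun y => u y s ^ p) x

lemma setLIntegral_one_add_rpow_le {c t : ℝ} (hc : 0 < c) (ht : 0 < t) :
    ∫⁻ s in Ioo (0:ℝ) t, ENNReal.ofReal ((1 + s) ^ (c - 1))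
      ≤ ENNReal.ofReal ((1 + t) ^ c / c) := by
  have hcont : ContinuousOn (fun s : ℝ => (1 + s) ^ (c - 1)) (Icc 0 t) := by
    intro s hs
    refine ContinuousAt.continuousWithinAt ?_
    refine ContinuousAt.rpow_const (by fun_prop) (Or.inl ?_)
    have := hs.1
    positivity
  have hint : IntegrableOn (fun s : ℝ => (1 + s) ^ (c - 1)) (Ioo 0 t) :=
    (hcont.integrableOn_Icc).mono_set Ioo_subset_Icc_self
  rw [← ofReal_integral_eq_lintegral_ofReal hint
    ((ae_restrict_iff' measurableSet_Ioo).2 <| .of_forall fun s hs => by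
      have := hs.1
      simp only [Pi.zero_apply]
      positivity)]
  refine ENNReal.ofReal_le_ofReal ?_
  rw [← integral_Ioc_eq_integral_Ioo, ← intervalIntegral.integral_of_le ht.le,
    intervalIntegral.integral_comp_add_left (fun s : ℝ => s ^ (c - 1)) 1,
    integral_rpow (Or.inl (by linarith))]
  simp only [sub_add_cancel, add_zero, Real.one_rpow]
  gcongr
  linarith

section Kernel

variable {α : Type*} [MeasureSpace α] {K : α → α → ℝ → ℝ≥0∞}

lemma kernelOp_mono (t : ℝ) {f g : α → ℝ≥0∞} (h : ∀ y, f y ≤ g y) (x : α) :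
    kernelOp K t f x ≤ kernelOp K t g x :=
  lintegral_mono fun y => mul_le_mul_right (h y) _

lemma duhamelMap_mono {p : ℝ} (hp : 0 ≤ p) (f : α → ℝ≥0∞) {u v : α → ℝ → ℝ≥0∞} {t : ℝ}
    (h : ∀ y, ∀ s ∈ Ioo (0:ℝ) t, u y s ≤ v y s) (x : α) :
    duhamelMap K p f u x t ≤ duhamelMap K p f v x t := by
  refine add_le_add_right ?_ _
  refine setLIntegral_mono' measurableSet_Ioo fun s hs => ?_
  exact kernelOp_mono _ (fun y => ENNReal.rpow_le_rpow (h y s hs) hp) x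

lemma kernelOp_le_rpow (hK : Measurable (fun q : α × α × ℝ => K q.1 q.2.1 q.2.2))
    {r : ℝ} (hr : 1 < r) {w : α → ℝ≥0∞} (hw : Measurable w) {t : ℝ} {x : α}
    (h1 : ∫⁻ y, K x y t = 1) :
    kernelOp K t w x ≤ kernelOp K t (fun y => w y ^ r) x ^ (1 / r) := by
  have hr0 : 0 < r := one_pos.trans hr
  have hmK : Measurable fun y => K x y t := hK.comp (by fun_prop : Measurable fun y : α => (x, y, t))
  have hc := Real.HolderConjugate.conjExponent hr
  set q := Real.conjExponent r
  have hq : 0 < q := hc.symm.pos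
  have h := ENNReal.lintegral_mul_le_Lp_mul_Lq volume hc
    (f := fun y => K x y t ^ (1 / r) * w y) (g := fun y => K x y t ^ (1 / q))
    ((hmK.pow_const _).mul hw).aemeasurable (hmK.pow_const _).aemeasurable
  have e1 : ∀ y, ((fun y => K x y t ^ (1 / r) * w y) * fun y => K x y t ^ (1 / q)) y
      = K x y t * w y := by
    intro y
    have : K x y t ^ (1 / r) * K x y t ^ (1 / q) = K x y t := by
      rw [← ENNReal.rpow_add_of_nonneg _ _ (by positivity) (by positivity)]
      have := hc.inv_add_inv_eq_one
      simp [this]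
    simp only [Pi.mul_apply]
    rw [mul_right_comm, this]
  have e2 : ∀ y, (K x y t ^ (1 / r) * w y) ^ r = K x y t * w y ^ r := by
    intro y
    rw [ENNReal.mul_rpow_of_nonneg _ _ hr0.le, ← ENNReal.rpow_mul, one_div_mul_cancel hr0.ne',
      ENNReal.rpow_one]
  have e3 : ∀ y, (K x y t ^ (1 / q)) ^ q = K x y t := by
    intro y
    rw [← ENNReal.rpow_mul, one_div_mul_cancel hq.ne', ENNReal.rpow_one]
  simp only [e1, e2, e3, h1, ENNReal.one_rpow, mul_one] at h
  exact h

variable [SFinite (volume : Measure α)]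

lemma measurable_kernelOp
    (hK : Measurable (fun q : α × α × ℝ => K q.1 q.2.1 q.2.2))
    {f : α → ℝ≥0∞} (hf : Measurable f) :
    Measurable (fun q : α × ℝ => kernelOp K q.2 f q.1) := by
  have : Measurable (fun r : (α × ℝ) × α => K r.1.1 r.2 r.1.2 * f r.2) :=
    (hK.comp (by fun_prop : Measurable fun r : (α × ℝ) × α => (r.1.1, r.2, r.1.2))).mul
      (hf.comp measurable_snd)
  exact this.lintegral_prod_right'

lemma measurable_kernelOp_sub
    (hK : Measurable (fun q : α × α × ℝ => K q.1 q.2.1 q.2.2))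
    {v : α → ℝ → ℝ≥0∞}
    (hv : Measurable (fun q : α × ℝ => v q.1 q.2)) :
    Measurable (fun r : (α × ℝ) × ℝ => kernelOp K (r.1.2 - r.2) (fun y => v y r.2) r.1.1) := by
  have : Measurable (fun r : ((α × ℝ) × ℝ) × α =>
      K r.1.1.1 r.2 (r.1.1.2 - r.1.2) * v r.2 r.1.2) :=
    (hK.comp (by fun_prop : Measurable fun r : ((α × ℝ) × ℝ) × α =>
      (r.1.1.1, r.2, r.1.1.2 - r.1.2))).mul
      (hv.comp (by fun_prop : Measurable fun r : ((α × ℝ) × ℝ) × α => (r.2, r.1.2)))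
  exact this.lintegral_prod_right'

lemma measurable_duhamelMap
    (hK : Measurable (fun q : α × α × ℝ => K q.1 q.2.1 q.2.2))
    (p : ℝ) {f : α → ℝ≥0∞} (hf : Measurable f) {u : α → ℝ → ℝ≥0∞}
    (hu : Measurable (fun q : α × ℝ => u q.1 q.2)) :
    Measurable (fun q : α × ℝ => duhamelMap K p f u q.1 q.2) := by
  refine (measurable_kernelOp hK hf).add ?_
  have hset : MeasurableSet {r : (α × ℝ) × ℝ | 0 < r.2 ∧ r.2 < r.1.2} :=
    (measurableSet_lt measurable_const measurable_snd).inter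
      (measurableSet_lt measurable_snd measurable_fst.snd)
  have := ((measurable_kernelOp_sub hK (v := fun y s => u y s ^ p) (hu.pow_const p)).indicator hset).lintegral_prod_right'
    (ν := (volume : Measure ℝ))
  refine (congrArg Measurable (funext fun q => ?_)).mpr this
  rw [← lintegral_indicator measurableSet_Ioo]
  rfl

/-- Monotone iteration: a supersolution of the Duhamel equation dominates a solution. -/
lemma exists_duhamelMap_fixedPoint
    (hK : Measurable (fun q : α × α × ℝ => K q.1 q.2.1 q.2.2))
    {p : ℝ} (hp : 0 < p) {f : α → ℝ≥0∞} (hf : Measurable f)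
    {U : α → ℝ → ℝ≥0∞} (hU : ∀ x, ∀ t, 0 < t → duhamelMap K p f U x t ≤ U x t) :
    ∃ u : α → ℝ → ℝ≥0∞, Measurable (fun q : α × ℝ => u q.1 q.2) ∧
      (∀ x, ∀ t, 0 < t → u x t ≤ U x t) ∧ ∀ x t, u x t = duhamelMap K p f u x t := by
  set v : ℕ → α → ℝ → ℝ≥0∞ := fun n => (duhamelMap K p f)^[n] (fun _ _ => 0) with hv
  have hv_succ : ∀ n, v (n + 1) = duhamelMap K p f (v n) := fun n =>
    Function.iterate_succ_apply' _ _ _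
  have hmeas : ∀ n, Measurable (fun q : α × ℝ => v n q.1 q.2) := by
    intro n
    induction n with
    | zero => exact measurable_const
    | succ n ih => rw [hv_succ]; exact measurable_duhamelMap hK p hf ih
  have hmono : ∀ n x t, v n x t ≤ v (n + 1) x t := by
    intro n
    induction n with
    | zero => intro x t; exact zero_le
    | succ n ih =>
      intro x t
      rw [hv_succ (n + 1), hv_succ n]
      rw [hv_succ] at ih
      exact duhamelMap_mono hp.le f (fun y s _ => ih y s) x
  have hle : ∀ n x t, 0 < t → v n x t ≤ U x t := by
    intro n
    induction n with
    | zero => intro x t _; exact zero_le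
    | succ n ih =>
      intro x t ht
      rw [hv_succ]
      exact (duhamelMap_mono hp.le f (fun y s hs => ih y s hs.1) x).trans (hU x t ht)
  have hm : ∀ x t, Monotone fun n => v n x t := fun x t => monotone_nat_of_le_succ (hmono · x t)
  refine ⟨fun x t => ⨆ n, v n x t, Measurable.iSup hmeas, fun x t ht => iSup_le (hle · x t ht),
    fun x t => ?_⟩
  have hpow : ∀ y s, (⨆ n, v n y s) ^ p = ⨆ n, v n y s ^ p := fun y s =>
    (ENNReal.orderIsoRpow p hp).map_iSup _
  have hinner : ∀ s, kernelOp K (t - s) (fun y => (⨆ n, v n y s) ^ p) x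
      = ⨆ n, kernelOp K (t - s) (fun y => v n y s ^ p) x := by
    intro s
    simp only [kernelOp, hpow, ENNReal.mul_iSup]
    refine lintegral_iSup (fun n => ?_) ?_
    · exact (hK.comp (by fun_prop : Measurable fun y : α => (x, y, t - s))).mul
        (((hmeas n).comp (by fun_prop : Measurable fun y : α => (y, s))).pow_const p)
    · intro m n hmn y
      exact mul_le_mul_right (ENNReal.rpow_le_rpow (hm y s hmn) hp.le) _
  have hD : duhamelMap K p f (fun x t => ⨆ n, v n x t) x t
      = ⨆ n, duhamelMap K p f (v n) x t := by
    simp only [duhamelMap, hinner]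
    rw [lintegral_iSup, ENNReal.add_iSup]
    · intro n
      exact (measurable_kernelOp_sub hK (v := fun y s => v n y s ^ p) ((hmeas n).pow_const p)).comp
        (by fun_prop : Measurable fun s : ℝ => ((x, t), s))
    · intro m n hmn s
      exact kernelOp_mono _ (fun y => ENNReal.rpow_le_rpow (hm y s hmn) hp.le) x
  rw [hD]
  simp only [← hv_succ]
  exact ((hm x t).iSup_nat_add 1).symm


lemma kernelOp_kernelOp
    (hK : Measurable (fun q : α × α × ℝ => K q.1 q.2.1 q.2.2))
    (hK2 : ∀ x y, ∀ s t : ℝ, 0 < s → s < t → K x y t = ∫⁻ ξ, K x ξ (t - s) * K ξ y s)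
    {g : α → ℝ≥0∞} (hg : Measurable g) {s t : ℝ} (hs : 0 < s) (hst : s < t) (x : α) :
    kernelOp K (t - s) (kernelOp K s g) x = kernelOp K t g x := by
  have hm : Measurable fun q : α × α => K x q.1 (t - s) * (K q.1 q.2 s * g q.2) :=
    (hK.comp (by fun_prop : Measurable fun q : α × α => (x, q.1, t - s))).mul
      ((hK.comp (by fun_prop : Measurable fun q : α × α => (q.1, q.2, s))).mul
        (hg.comp measurable_snd))
  have hm₁ : ∀ ξ, Measurable fun y => K ξ y s * g y := fun ξ =>
    (hK.comp (by fun_prop : Measurable fun y : α => (ξ, y, s))).mul hg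
  have hm₂ : ∀ y, Measurable fun ξ => K x ξ (t - s) * K ξ y s := fun y =>
    (hK.comp (by fun_prop : Measurable fun ξ : α => (x, ξ, t - s))).mul
      (hK.comp (by fun_prop : Measurable fun ξ : α => (ξ, y, s)))
  calc kernelOp K (t - s) (kernelOp K s g) x
      = ∫⁻ ξ, ∫⁻ y, K x ξ (t - s) * (K ξ y s * g y) := by
        refine lintegral_congr fun ξ => ?_
        rw [lintegral_const_mul _ (hm₁ ξ), kernelOp]
    _ = ∫⁻ y, ∫⁻ ξ, K x ξ (t - s) * (K ξ y s * g y) :=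
        lintegral_lintegral_swap hm.aemeasurable
    _ = kernelOp K t g x := by
        refine lintegral_congr fun y => ?_
        simp_rw [← mul_assoc]
        rw [lintegral_mul_const _ (hm₂ y), ← hK2 x y s t hs hst]

/-- For small `δ`, the function `2δ (S(t) w^r)^{1/r}` is a supersolution of the Duhamel equation
for data dominated by `δ w`, provided `S(t) w^r` decays at the rate `(1+t)^{-r/(p-1)}`. -/
lemma exists_supersolution
    (hK : Measurable (fun q : α × α × ℝ => K q.1 q.2.1 q.2.2))
    (hK1 : ∀ x, ∀ t : ℝ, 0 < t → ∫⁻ y, K x y t = 1)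
    (hK2 : ∀ x y, ∀ s t : ℝ, 0 < s → s < t → K x y t = ∫⁻ ξ, K x ξ (t - s) * K ξ y s)
    {p r B : ℝ} (hr : 1 < r) (hrp : r < p) (hB : 0 < B) {w : α → ℝ≥0∞} (hw : Measurable w)
    (hV : ∀ x, ∀ t : ℝ, 0 < t → kernelOp K t (fun y => w y ^ r) x
      ≤ ENNReal.ofReal (B * (1 + t) ^ (-(r / (p - 1))))) :
    ∃ δ : ℝ, 0 < δ ∧ ∀ f : α → ℝ≥0∞, (∀ x, f x ≤ ENNReal.ofReal δ * w x) →
      ∀ x, ∀ t : ℝ, 0 < t →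
        duhamelMap K p f (fun x t => ENNReal.ofReal (2 * δ) *
          kernelOp K t (fun y => w y ^ r) x ^ (1 / r)) x t
        ≤ ENNReal.ofReal (2 * δ) * kernelOp K t (fun y => w y ^ r) x ^ (1 / r) := by
  have hr0 : 0 < r := one_pos.trans hr
  have hp1 : 0 < p - 1 := by linarith
  set c := (r - 1) / (p - 1) with hc
  have hc0 : 0 < c := div_pos (by linarith) hp1
  set ψ : α → ℝ≥0∞ := fun y => w y ^ r with hψ
  have hψm : Measurable ψ := hw.pow_const r
  -- the total constant produced by the nonlinear term
  set A : ℝ := B ^ (p / r - 1) * (B ^ (1 - 1 / r) / c) with hA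
  have hA0 : 0 < A := by positivity
  have key : ∀ x, ∀ t : ℝ, 0 < t →
      ∫⁻ s in Ioo (0:ℝ) t, kernelOp K (t - s) (fun y => kernelOp K s ψ y ^ (p / r)) x
        ≤ ENNReal.ofReal A * kernelOp K t ψ x ^ (1 / r) := by
    intro x t ht
    have hVt := hV x t ht
    have step : ∀ s ∈ Ioo (0:ℝ) t, kernelOp K (t - s) (fun y => kernelOp K s ψ y ^ (p / r)) x
        ≤ ENNReal.ofReal (B ^ (p / r - 1)) * ENNReal.ofReal ((1 + s) ^ (c - 1))
          * kernelOp K t ψ x := by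
      intro s hs
      have h1s : 0 < 1 + s := by linarith [hs.1]
      have e : (B * (1 + s) ^ (-(r / (p - 1)))) ^ (p / r - 1)
          = B ^ (p / r - 1) * (1 + s) ^ (c - 1) := by
        rw [Real.mul_rpow hB.le (by positivity), ← Real.rpow_mul h1s.le]
        congr 2
        rw [hc]
        field_simp
        ring
      have hb : ∀ y, kernelOp K s ψ y ^ (p / r)
          ≤ ENNReal.ofReal (B ^ (p / r - 1) * (1 + s) ^ (c - 1)) * kernelOp K s ψ y := by
        intro y
        have hpr : 0 ≤ p / r - 1 := by
          rw [sub_nonneg, one_le_div hr0]; exact hrp.le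
        calc kernelOp K s ψ y ^ (p / r)
            = kernelOp K s ψ y ^ (p / r - 1) * kernelOp K s ψ y := by
              conv_lhs => rw [← sub_add_cancel (p / r) 1]
              rw [ENNReal.rpow_add_of_nonneg _ _ hpr zero_le_one, ENNReal.rpow_one]
          _ ≤ _ := by
              gcongr
              rw [← e, ← ENNReal.ofReal_rpow_of_nonneg (by positivity) hpr]
              exact ENNReal.rpow_le_rpow (hV y s hs.1) hpr
      refine (kernelOp_mono _ hb x).trans ?_
      rw [← ENNReal.ofReal_mul (by positivity), ← kernelOp_kernelOp hK hK2 hψm hs.1 hs.2 x]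
      simp only [kernelOp]
      rw [← lintegral_const_mul' _ _ ENNReal.ofReal_ne_top]
      refine lintegral_mono fun y => ?_
      rw [mul_left_comm]
    have hVr : kernelOp K t ψ x ≤ ENNReal.ofReal (B ^ (1 - 1 / r) * (1 + t) ^ (-c))
        * kernelOp K t ψ x ^ (1 / r) := by
      have h1r : 0 ≤ 1 - 1 / r := by
        rw [sub_nonneg, div_le_one hr0]; exact hr.le
      have e : (B * (1 + t) ^ (-(r / (p - 1)))) ^ (1 - 1 / r)
          = B ^ (1 - 1 / r) * (1 + t) ^ (-c) := by
        rw [Real.mul_rpow hB.le (by positivity), ← Real.rpow_mul (by positivity)]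
        congr 2
        rw [hc]
        field_simp
      calc kernelOp K t ψ x = kernelOp K t ψ x ^ (1 - 1 / r) * kernelOp K t ψ x ^ (1 / r) := by
            rw [← ENNReal.rpow_add_of_nonneg _ _ h1r (by positivity), sub_add_cancel,
              ENNReal.rpow_one]
        _ ≤ _ := by
            gcongr
            rw [← e, ← ENNReal.ofReal_rpow_of_nonneg (by positivity) h1r]
            exact ENNReal.rpow_le_rpow hVt h1r
    calc ∫⁻ s in Ioo (0:ℝ) t, kernelOp K (t - s) (fun y => kernelOp K s ψ y ^ (p / r)) x
        ≤ ∫⁻ s in Ioo (0:ℝ) t, ENNReal.ofReal (B ^ (p / r - 1)) *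
            ENNReal.ofReal ((1 + s) ^ (c - 1)) * kernelOp K t ψ x :=
          setLIntegral_mono' measurableSet_Ioo step
      _ = ENNReal.ofReal (B ^ (p / r - 1)) *
            (∫⁻ s in Ioo (0:ℝ) t, ENNReal.ofReal ((1 + s) ^ (c - 1))) * kernelOp K t ψ x := by
          rw [lintegral_mul_const _ (by fun_prop), lintegral_const_mul _ (by fun_prop)]
      _ ≤ ENNReal.ofReal (B ^ (p / r - 1)) * ENNReal.ofReal ((1 + t) ^ c / c) *
            (ENNReal.ofReal (B ^ (1 - 1 / r) * (1 + t) ^ (-c)) * kernelOp K t ψ x ^ (1 / r)) := by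
          gcongr
          exact setLIntegral_one_add_rpow_le hc0 ht
      _ = ENNReal.ofReal A * kernelOp K t ψ x ^ (1 / r) := by
          rw [← mul_assoc, ← ENNReal.ofReal_mul (by positivity),
            ← ENNReal.ofReal_mul (by positivity)]
          congr 2
          rw [hA, Real.rpow_neg (by positivity)]
          have : (1 + t) ^ c ≠ 0 := by positivity
          field_simp
  -- choose `δ` with `(2δ)^p A = δ`
  refine ⟨(2 ^ p * A) ^ (-(1 / (p - 1))), by positivity, ?_⟩
  set δ : ℝ := (2 ^ p * A) ^ (-(1 / (p - 1))) with hδ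
  have hδ0 : 0 < δ := by positivity
  have hδp : (2 * δ) ^ p * A = δ := by
    have h1 : δ ^ (p - 1) = (2 ^ p * A)⁻¹ := by
      rw [hδ, ← Real.rpow_mul (by positivity), ← Real.rpow_neg_one]
      congr 1
      field_simp
    have h2 : δ ^ p = δ ^ (p - 1) * δ := by
      rw [← Real.rpow_add_one hδ0.ne', sub_add_cancel]
    rw [Real.mul_rpow (by norm_num) hδ0.le, h2, h1]
    field_simp
  intro f hf x t ht
  have hlin : kernelOp K t f x ≤ ENNReal.ofReal δ * kernelOp K t ψ x ^ (1 / r) := by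
    calc kernelOp K t f x ≤ kernelOp K t (fun y => ENNReal.ofReal δ * w y) x :=
          kernelOp_mono _ hf x
      _ = ENNReal.ofReal δ * kernelOp K t w x := by
          simp only [kernelOp]
          rw [← lintegral_const_mul' _ _ ENNReal.ofReal_ne_top]
          exact lintegral_congr fun y => mul_left_comm _ _ _
      _ ≤ _ := by
          gcongr
          exact kernelOp_le_rpow hK hr hw (hK1 x t ht)
  have hnl : ∫⁻ s in Ioo (0:ℝ) t, kernelOp K (t - s)
      (fun y => (ENNReal.ofReal (2 * δ) * kernelOp K s ψ y ^ (1 / r)) ^ p) x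
      ≤ ENNReal.ofReal δ * kernelOp K t ψ x ^ (1 / r) := by
    have e : ∀ s, kernelOp K (t - s)
        (fun y => (ENNReal.ofReal (2 * δ) * kernelOp K s ψ y ^ (1 / r)) ^ p) x
        = ENNReal.ofReal ((2 * δ) ^ p) *
          kernelOp K (t - s) (fun y => kernelOp K s ψ y ^ (p / r)) x := by
      intro s
      simp only [kernelOp]
      rw [← lintegral_const_mul' _ _ ENNReal.ofReal_ne_top]
      refine lintegral_congr fun y => ?_
      rw [ENNReal.mul_rpow_of_nonneg _ _ (by linarith), ← ENNReal.rpow_mul,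
        ENNReal.ofReal_rpow_of_nonneg (by positivity) (by linarith), one_div_mul_eq_div,
        mul_left_comm]
    simp only [e]
    rw [lintegral_const_mul' _ _ ENNReal.ofReal_ne_top]
    calc _ ≤ ENNReal.ofReal ((2 * δ) ^ p) * (ENNReal.ofReal A * kernelOp K t ψ x ^ (1 / r)) := by
          gcongr
          exact key x t ht
      _ = _ := by
          rw [← mul_assoc, ← ENNReal.ofReal_mul (by positivity), hδp]
  refine (add_le_add hlin hnl).trans_eq ?_
  rw [← add_mul, ← ENNReal.ofReal_add hδ0.le hδ0.le, two_mul]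

end Kernel

section Euclidean

variable {N : ℕ}

lemma setLIntegral_ball_norm_rpow_le (hN : 1 ≤ N) {m : ℝ} (hm : m < N) :
    ∃ C : ℝ, 0 < C ∧ ∀ R : ℝ, 0 < R →
      ∫⁻ y in Metric.ball (0 : E N) R, ENNReal.ofReal (‖y‖ ^ (-m))
        ≤ ENNReal.ofReal (C * R ^ ((N : ℝ) - m)) := by
  have hmeas : Measurable fun y : E N => ‖y‖ ^ (-m) := by fun_prop
  have hint : ∀ R : ℝ, IntegrableOn (fun y : E N => ‖y‖ ^ (-m)) (Metric.ball 0 R) := by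
    intro R
    refine integrableOn_ball_of_norm_le_rpow (C := 1) (α := m) (by simpa using hN)
      (by simpa using hm) (.of_forall fun y => ?_) hmeas.aestronglyMeasurable
    rw [one_mul, Real.norm_of_nonneg (by positivity)]
  set I : ℝ := ∫ y in Metric.ball (0 : E N) 1, ‖y‖ ^ (-m) with hI
  have hI0 : 0 ≤ I := integral_nonneg fun y => by positivity
  refine ⟨I + 1, by linarith, fun R hR => ?_⟩
  rw [← ofReal_integral_eq_lintegral_ofReal (hint R) (.of_forall fun y => by
    simp only [Pi.zero_apply]; positivity)]
  refine ENNReal.ofReal_le_ofReal ?_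
  have h := Measure.setIntegral_comp_smul_of_pos (volume : Measure (E N))
    (fun y : E N => ‖y‖ ^ (-m)) (Metric.ball 0 1) hR
  rw [smul_unitBall_of_pos hR] at h
  have h' : ∫ y in Metric.ball (0 : E N) 1, ‖R • y‖ ^ (-m) = R ^ (-m) * I := by
    rw [hI, ← integral_const_mul]
    congr 1
    ext y
    rw [norm_smul, Real.norm_of_nonneg hR.le, Real.mul_rpow hR.le (norm_nonneg _)]
  rw [h', smul_eq_mul, finrank_euclideanSpace_fin] at h
  have h2 : ∫ y in Metric.ball (0 : E N) R, ‖y‖ ^ (-m) = I * R ^ ((N : ℝ) - m) := by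
    rw [sub_eq_add_neg, Real.rpow_add hR, Real.rpow_natCast]
    field_simp at h
    linarith
  rw [h2]
  gcongr
  linarith

variable {K : E N → E N → ℝ → ℝ≥0∞} {ψ : E N → ℝ≥0∞} {m C : ℝ}

lemma kernelOp_le_indicator_add (hK1 : ∀ x, ∀ t : ℝ, 0 < t → ∫⁻ y, K x y t = 1)
    (hK : Measurable (fun q : E N × E N × ℝ => K q.1 q.2.1 q.2.2)) {b : ℝ≥0∞} {R : ℝ}
    (hψ : ∀ y : E N, R ≤ ‖y‖ → ψ y ≤ b) {t : ℝ} (ht : 0 < t) (x : E N) :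
    kernelOp K t ψ x ≤ kernelOp K t ((Metric.ball 0 R).indicator ψ) x + b := by
  have hmK : Measurable fun y => K x y t :=
    hK.comp (by fun_prop : Measurable fun y : E N => (x, y, t))
  calc kernelOp K t ψ x
      ≤ ∫⁻ y, (K x y t * (Metric.ball 0 R).indicator ψ y + K x y t * b) := by
        refine lintegral_mono fun y => ?_
        rw [← mul_add]
        refine mul_le_mul_right ?_ _
        by_cases hy : y ∈ Metric.ball (0 : E N) R
        · rw [indicator_of_mem hy]; exact le_self_add
        · rw [mem_ball_zero_iff, not_lt] at hy
          exact (hψ y hy).trans le_add_self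
    _ = _ := by
        rw [lintegral_add_right _ (hmK.mul_const b), lintegral_mul_const _ hmK, hK1 x t ht,
          one_mul, kernelOp]

lemma exists_kernelOp_le_rpow (hK1 : ∀ x, ∀ t : ℝ, 0 < t → ∫⁻ y, K x y t = 1)
    (hK : Measurable (fun q : E N × E N × ℝ => K q.1 q.2.1 q.2.2)) {β C₀ : ℝ} (hβ : 0 < β)
    (hC₀ : 0 < C₀) (hsup : ∀ x y, ∀ t : ℝ, 0 < t →
      K x y t ≤ ENNReal.ofReal (C₀ * t ^ (-(N : ℝ) / β)))
    (hm : 0 < m) (hC : 0 < C) (hψ₀ : ∀ y, ψ y ≤ 1)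
    (hψ₁ : ∀ R : ℝ, 0 < R → ∀ y : E N, R ≤ ‖y‖ → ψ y ≤ ENNReal.ofReal (R ^ (-m)))
    (hψ₂ : ∀ R : ℝ, 0 < R → ∫⁻ y in Metric.ball (0 : E N) R, ψ y
      ≤ ENNReal.ofReal (C * R ^ ((N : ℝ) - m))) :
    ∃ B : ℝ, 0 < B ∧ ∀ x, ∀ t : ℝ, 0 < t →
      kernelOp K t ψ x ≤ ENNReal.ofReal (B * (1 + t) ^ (-(m / β))) := by
  set D := C₀ * C + 1 with hD
  have hD1 : 1 ≤ D := by have := mul_pos hC₀ hC; linarith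
  have hmβ : 0 < m / β := by positivity
  have hdec : ∀ x, ∀ t : ℝ, 0 < t → kernelOp K t ψ x ≤ ENNReal.ofReal (D * t ^ (-(m / β))) := by
    intro x t ht
    have hR : 0 < t ^ (1 / β) := by positivity
    refine (kernelOp_le_indicator_add hK1 hK (hψ₁ _ hR) ht x).trans ?_
    have h1 : kernelOp K t ((Metric.ball 0 (t ^ (1 / β))).indicator ψ) x
        ≤ ENNReal.ofReal (C₀ * t ^ (-(N : ℝ) / β)) *
          ENNReal.ofReal (C * (t ^ (1 / β)) ^ ((N : ℝ) - m)) := by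
      refine (lintegral_mono fun y => mul_le_mul_left (hsup x y t ht) _).trans ?_
      rw [lintegral_const_mul' _ _ ENNReal.ofReal_ne_top,
        lintegral_indicator Metric.isOpen_ball.measurableSet]
      gcongr
      exact hψ₂ _ hR
    refine (add_le_add_left h1 _).trans_eq ?_
    rw [← ENNReal.ofReal_mul (by positivity), ← ENNReal.ofReal_add (by positivity) (by positivity)]
    congr 1
    have e1 : (t ^ (1 / β)) ^ (-m) = t ^ (-(m / β)) := by
      rw [← Real.rpow_mul ht.le]; congr 1; ring
    have e2 : t ^ (-(N : ℝ) / β) * (t ^ (1 / β)) ^ ((N : ℝ) - m) = t ^ (-(m / β)) := by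
      rw [← Real.rpow_mul ht.le, ← Real.rpow_add ht]; congr 1; ring
    rw [e1, hD, add_mul, one_mul, ← e2]
    ring
  have hone : ∀ x, ∀ t : ℝ, 0 < t → kernelOp K t ψ x ≤ 1 := by
    intro x t ht
    rw [← hK1 x t ht]
    refine lintegral_mono fun y => ?_
    simpa using mul_le_mul_right (hψ₀ y) (K x y t)
  refine ⟨D * 2 ^ (m / β), by positivity, fun x t ht => ?_⟩
  rcases le_total t 1 with h | h
  · refine (hone x t ht).trans ?_
    rw [ENNReal.one_le_ofReal, mul_assoc, Real.rpow_neg (by positivity), ← div_eq_mul_inv,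
      ← Real.div_rpow (by norm_num) (by positivity)]
    have : 1 ≤ (2 / (1 + t)) ^ (m / β) := by
      refine Real.one_le_rpow ?_ hmβ.le
      rw [one_le_div (by positivity)]; linarith
    nlinarith
  · refine (hdec x t ht).trans (ENNReal.ofReal_le_ofReal ?_)
    rw [mul_assoc]
    refine mul_le_mul_of_nonneg_left ?_ (by positivity)
    calc t ^ (-(m / β)) = 2 ^ (m / β) * (2 * t) ^ (-(m / β)) := by
          rw [Real.mul_rpow (by norm_num) ht.le, ← mul_assoc, ← Real.rpow_add (by norm_num)]
          simp
      _ ≤ _ := by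
          refine mul_le_mul_of_nonneg_left ?_ (by positivity)
          refine Real.rpow_le_rpow_of_nonpos (by positivity) (by linarith) (by linarith)

lemma volume_lt_kernelOp_le (hK1 : ∀ x, ∀ t : ℝ, 0 < t → ∫⁻ y, K x y t = 1)
    (hK1' : ∀ y, ∀ t : ℝ, 0 < t → ∫⁻ x, K x y t = 1)
    (hK : Measurable (fun q : E N × E N × ℝ => K q.1 q.2.1 q.2.2)) (hψm : Measurable ψ)
    (hψ₁ : ∀ R : ℝ, 0 < R → ∀ y : E N, R ≤ ‖y‖ → ψ y ≤ ENNReal.ofReal (R ^ (-m)))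
    (hψ₂ : ∀ R : ℝ, 0 < R → ∫⁻ y in Metric.ball (0 : E N) R, ψ y
      ≤ ENNReal.ofReal (C * R ^ ((N : ℝ) - m))) {R t : ℝ} (hR : 0 < R) (ht : 0 < t) :
    volume {x | ENNReal.ofReal (2 * R ^ (-m)) < kernelOp K t ψ x}
      ≤ ENNReal.ofReal (C * R ^ (N : ℝ)) := by
  set g : E N → ℝ≥0∞ := (Metric.ball 0 R).indicator ψ with hg
  have hgm : Measurable g := hψm.indicator Metric.isOpen_ball.measurableSet
  have hsub : {x | ENNReal.ofReal (2 * R ^ (-m)) < kernelOp K t ψ x}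
      ⊆ {x | ENNReal.ofReal (R ^ (-m)) ≤ kernelOp K t g x} := by
    intro x hx
    simp only [mem_ofPred_eq] at hx ⊢
    by_contra! hlt
    have h := kernelOp_le_indicator_add hK1 hK (hψ₁ R hR) ht x
    refine absurd (hx.trans_le (h.trans (add_le_add_left hlt.le _))) ?_
    rw [← ENNReal.ofReal_add (by positivity) (by positivity), two_mul]
    exact lt_irrefl _
  have hmass : ∫⁻ x, kernelOp K t g x = ∫⁻ y, g y := by
    have hm : Measurable fun q : E N × E N => K q.1 q.2 t * g q.2 :=
      (hK.comp (by fun_prop : Measurable fun q : E N × E N => (q.1, q.2, t))).mul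
        (hgm.comp measurable_snd)
    calc ∫⁻ x, kernelOp K t g x = ∫⁻ y, ∫⁻ x, K x y t * g y :=
          lintegral_lintegral_swap hm.aemeasurable
      _ = _ := by
          refine lintegral_congr fun y => ?_
          have hmy : Measurable fun x => K x y t :=
            hK.comp (by fun_prop : Measurable fun x : E N => (x, y, t))
          rw [lintegral_mul_const _ hmy, hK1' y t ht, one_mul]
  have hgm' : Measurable (kernelOp K t g) :=
    (measurable_kernelOp hK hgm).comp (by fun_prop : Measurable fun x : E N => (x, t))
  have hmarkov := mul_meas_ge_le_lintegral (μ := volume) hgm' (ENNReal.ofReal (R ^ (-m)))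
  rw [hmass, hg, lintegral_indicator Metric.isOpen_ball.measurableSet] at hmarkov
  refine (measure_mono hsub).trans ?_
  have h := mul_le_mul_right (hmarkov.trans (hψ₂ R hR)) (ENNReal.ofReal (R ^ m))
  have hCC : ENNReal.ofReal (R ^ m) * ENNReal.ofReal (C * R ^ ((N : ℝ) - m))
      = ENNReal.ofReal (C * R ^ (N : ℝ)) := by
    rw [← ENNReal.ofReal_mul (by positivity)]
    congr 1
    rw [mul_left_comm, ← Real.rpow_add hR]
    congr 2
    ring
  have hone : ENNReal.ofReal (R ^ m) * ENNReal.ofReal (R ^ (-m)) = 1 := by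
    rw [← ENNReal.ofReal_mul (by positivity), ← Real.rpow_add hR]
    simp
  rwa [hCC, ← mul_assoc, hone, one_mul] at h

lemma isMildSolution_toReal {p : ℝ} (hp : 0 < p) {Γ : E N → E N → ℝ → ℝ}
    (hΓmeas : Measurable (fun q : E N × E N × ℝ => Γ q.1 q.2.1 q.2.2))
    (hΓnonneg : ∀ x y : E N, ∀ t : ℝ, 0 < t → 0 ≤ Γ x y t)
    {φ : E N → ℝ} (hφm : Measurable φ) (hφ : ∀ x, 0 ≤ φ x) {u : E N → ℝ → ℝ≥0∞}
    (hum : Measurable (fun q : E N × ℝ => u q.1 q.2)) {M : ℝ} (hM : 0 ≤ M)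
    (hle : ∀ x, ∀ t : ℝ, 0 < t → u x t ≤ ENNReal.ofReal M)
    (hfix : ∀ x t, u x t = duhamelMap (fun x y t => ENNReal.ofReal (Γ x y t)) p
      (fun x => ENNReal.ofReal (φ x)) u x t) :
    IsMildSolution N p Γ φ ⊤ (fun x t => (u x t).toReal) := by
  set K : E N → E N → ℝ → ℝ≥0∞ := fun x y t => ENNReal.ofReal (Γ x y t) with hKdef
  have hK : Measurable (fun q : E N × E N × ℝ => K q.1 q.2.1 q.2.2) := hΓmeas.ennreal_ofReal
  have hfin : ∀ x, ∀ t : ℝ, 0 < t → u x t ≠ ⊤ := fun x t ht =>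
    ne_top_of_le_ne_top ENNReal.ofReal_ne_top (hle x t ht)
  refine ⟨hum.ennreal_toReal, fun x t => ENNReal.toReal_nonneg, ⟨M, fun t ht _ => .of_forall
    fun x => ENNReal.toReal_le_of_le_ofReal hM (hle x t ht)⟩, fun t ht _ => .of_forall fun x => ?_⟩
  have hsum : kernelOp K t (fun x => ENNReal.ofReal (φ x)) x
      + ∫⁻ s in Ioo (0:ℝ) t, kernelOp K (t - s) (fun y => u y s ^ p) x ≠ ⊤ := by
    have := hfix x t
    rw [duhamelMap] at this
    rw [← this]
    exact hfin x t ht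
  obtain ⟨hlin, hnl⟩ := ENNReal.add_ne_top.1 hsum
  have hΓt : Measurable fun y => Γ x y t :=
    hΓmeas.comp (by fun_prop : Measurable fun y : E N => (x, y, t))
  have hterm : ∀ y, ∀ s ∈ Ioo (0:ℝ) t,
      (K x y (t - s) * u y s ^ p).toReal = Γ x y (t - s) * (u y s).toReal ^ p := by
    intro y s hs
    rw [ENNReal.toReal_mul, ENNReal.toReal_ofReal (hΓnonneg _ _ _ (sub_pos.2 hs.2)),
      ENNReal.toReal_rpow]
  have hterm_ne : ∀ y, ∀ s ∈ Ioo (0:ℝ) t, K x y (t - s) * u y s ^ p ≠ ⊤ := fun y s hs =>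
    ENNReal.mul_ne_top ENNReal.ofReal_ne_top (ENNReal.rpow_ne_top_of_nonneg hp.le (hfin y s hs.1))
  have hlin_eq : ∀ y, ENNReal.ofReal (Γ x y t * φ y) = K x y t * ENNReal.ofReal (φ y) :=
    fun y => ENNReal.ofReal_mul (hΓnonneg x y t ht)
  have hlin_nonneg : 0 ≤ᵐ[volume] fun y => Γ x y t * φ y :=
    .of_forall fun y => mul_nonneg (hΓnonneg x y t ht) (hφ y)
  refine ⟨?_, ?_, ?_⟩
  · refine (lintegral_ofReal_ne_top_iff_integrable (hΓt.mul hφm).aestronglyMeasurable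
      hlin_nonneg).1 ?_
    change ∫⁻ y, ENNReal.ofReal (Γ x y t * φ y) ≠ ⊤
    simp only [hlin_eq]
    exact hlin
  · have hm : Measurable fun q : E N × ℝ => Γ x q.1 (t - q.2) * (u q.1 q.2).toReal ^ p :=
      (hΓmeas.comp (by fun_prop : Measurable fun q : E N × ℝ => (x, q.1, t - q.2))).mul
        (hum.ennreal_toReal.pow_const p)
    refine ⟨hm.aestronglyMeasurable, ?_⟩
    rw [HasFiniteIntegral, lintegral_prod_symm _ hm.enorm.aemeasurable]
    refine lt_of_eq_of_lt (setLIntegral_congr_fun measurableSet_Ioo fun s hs => ?_)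
      hnl.lt_top
    refine lintegral_congr fun y => ?_
    change ‖Γ x y (t - s) * (u y s).toReal ^ p‖ₑ = _
    rw [← hterm y s hs, Real.enorm_eq_ofReal ENNReal.toReal_nonneg,
      ENNReal.ofReal_toReal (hterm_ne y s hs)]
  · have hinner : ∀ s ∈ Ioo (0:ℝ) t, ∫ y, Γ x y (t - s) * (u y s).toReal ^ p
        = (kernelOp K (t - s) (fun y => u y s ^ p) x).toReal := by
      intro s hs
      have hm : Measurable fun y => K x y (t - s) * u y s ^ p :=
        (hK.comp (by fun_prop : Measurable fun y : E N => (x, y, t - s))).mul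
          ((hum.comp (by fun_prop : Measurable fun y : E N => (y, s))).pow_const p)
      rw [kernelOp, ← integral_toReal hm.aemeasurable
        (.of_forall fun y => (hterm_ne y s hs).lt_top)]
      exact integral_congr_ae (.of_forall fun y => (hterm y s hs).symm)
    have hm : Measurable fun s => kernelOp K (t - s) (fun y => u y s ^ p) x :=
      (measurable_kernelOp_sub hK (v := fun y s => u y s ^ p) (hum.pow_const p)).comp
        (by fun_prop : Measurable fun s : ℝ => ((x, t), s))
    change (u x t).toReal = _
    rw [setIntegral_congr_fun measurableSet_Ioo hinner,
      integral_toReal hm.aemeasurable (ae_lt_top hm hnl), hfix x t, duhamelMap,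
      ENNReal.toReal_add hlin hnl, integral_eq_lintegral_of_nonneg_ae hlin_nonneg
        (hΓt.mul hφm).aestronglyMeasurable]
    simp only [hlin_eq]
    rfl

/-- Interpolation between the weak `L^ρ` quasinorm and the supremum norm. -/
lemma exists_weakNorm_le {v : E N → ℝ → ℝ} {M k D ρ : ℝ} (hM : 0 < M) (hD : 0 < D) (hρ : 0 < ρ)
    (hsup : ∀ x, ∀ t : ℝ, 0 < t → |v x t| ≤ M * (1 + t) ^ (-k))
    (hweak : ∀ t l : ℝ, 0 < t → 0 < l →
      volume {x | l < |v x t|} ≤ ENNReal.ofReal (D * l ^ (-ρ))) {q : ℝ} (hq : ρ ≤ q) :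
    ∃ C : ℝ≥0∞, C ≠ ⊤ ∧ ∀ t : ℝ, 0 < t →
      ENNReal.ofReal ((1 + t) ^ (k * (1 - ρ / q))) * weakNorm N q (fun x => v x t) ≤ C := by
  have hq0 : 0 < q := hρ.trans_le hq
  have he : 0 ≤ 1 - ρ / q := by rw [sub_nonneg, div_le_one hq0]; exact hq
  refine ⟨ENNReal.ofReal (D ^ (1 / q) * M ^ (1 - ρ / q)), ENNReal.ofReal_ne_top, fun t ht => ?_⟩
  rw [weakNorm, ENNReal.mul_iSup]
  refine iSup_le fun l => ?_
  rw [ENNReal.mul_iSup]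
  refine iSup_le fun hl => ?_
  rcases le_or_gt (M * (1 + t) ^ (-k)) l with h | h
  · have : {x : E N | l < |v x t|} = ∅ := by
      ext x
      simp only [mem_ofPred_eq, mem_empty_iff_false, iff_false, not_lt]
      exact (hsup x t ht).trans h
    rw [this, measure_empty, ENNReal.zero_rpow_of_pos (by positivity), mul_zero, mul_zero]
    exact zero_le
  · have h1 : volume {x : E N | l < |v x t|} ^ (1 / q)
        ≤ ENNReal.ofReal (D ^ (1 / q) * l ^ (-(ρ / q))) := by
      refine (ENNReal.rpow_le_rpow (hweak t l ht hl) (by positivity)).trans_eq ?_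
      rw [ENNReal.ofReal_rpow_of_nonneg (by positivity) (by positivity),
        Real.mul_rpow hD.le (by positivity), ← Real.rpow_mul hl.le]
      congr 3
      ring
    calc _ ≤ ENNReal.ofReal ((1 + t) ^ (k * (1 - ρ / q))) * (ENNReal.ofReal l *
          ENNReal.ofReal (D ^ (1 / q) * l ^ (-(ρ / q)))) := by gcongr
      _ ≤ _ := by
        rw [← ENNReal.ofReal_mul hl.le, ← ENNReal.ofReal_mul (by positivity)]
        refine ENNReal.ofReal_le_ofReal ?_
        have e1 : l * l ^ (-(ρ / q)) = l ^ (1 - ρ / q) := by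
          rw [sub_eq_add_neg, Real.rpow_add hl, Real.rpow_one]
        have e2 : l ^ (1 - ρ / q) ≤ M ^ (1 - ρ / q) * (1 + t) ^ (-(k * (1 - ρ / q))) := by
          refine (Real.rpow_le_rpow hl.le h.le he).trans_eq ?_
          rw [Real.mul_rpow hM.le (by positivity), ← Real.rpow_mul (by positivity), neg_mul]
        calc (1 + t) ^ (k * (1 - ρ / q)) * (l * (D ^ (1 / q) * l ^ (-(ρ / q))))
            = D ^ (1 / q) * ((1 + t) ^ (k * (1 - ρ / q)) * l ^ (1 - ρ / q)) := by
              rw [← e1]; ring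
          _ ≤ D ^ (1 / q) * ((1 + t) ^ (k * (1 - ρ / q)) *
              (M ^ (1 - ρ / q) * (1 + t) ^ (-(k * (1 - ρ / q))))) := by gcongr
          _ = D ^ (1 / q) * M ^ (1 - ρ / q) := by
              rw [Real.rpow_neg (by positivity)]
              have : (1 + t) ^ (k * (1 - ρ / q)) ≠ 0 := by positivity
              field_simp

end Euclidean

/-- Corollary 1.1 (case `α = a`): global existence for initial data pointwise
dominated by `δ/(1+|x|^{(2-a)/(p-1)})`, with decay of the weak `L^q` norms for
`r_* ≤ q ≤ ∞`, where `r_* = N(p-1)/(2-a)`. -/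
theorem global_existence_pointwise_data_line_weight
    (N : ℕ) (hN : 1 ≤ N) (a : ℝ) (ha1 : -1 < a) (ha2 : a < 1) (haN : a * N < 2)
    (p : ℝ) (hp : 1 + (2 - a) / N < p)
    (rs : ℝ) (hrs : rs = N * (p - 1) / (2 - a))
    (Γ : E N → E N → ℝ → ℝ)
    (hΓmeas : Measurable (fun q : E N × E N × ℝ => Γ q.1 q.2.1 q.2.2))
    (hΓnonneg : ∀ x y : E N, ∀ t : ℝ, 0 < t → 0 ≤ Γ x y t)
    (hK1x : ∀ y : E N, ∀ t : ℝ, 0 < t → ∫ x : E N, Γ x y t = 1)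
    (hK1y : ∀ x : E N, ∀ t : ℝ, 0 < t → ∫ y : E N, Γ x y t = 1)
    (hK2 : ∀ x y : E N, ∀ s t : ℝ, 0 < s → s < t →
      Γ x y t = ∫ ξ : E N, Γ x ξ (t - s) * Γ ξ y s)
    (hupp : ∃ C₀ c₀ : ℝ, 0 < C₀ ∧ 0 < c₀ ∧ ∀ x y : E N, ∀ t : ℝ, 0 < t →
      Γ x y t ≤ C₀ * t ^ (-(N : ℝ) / (2 - a)) *
        Real.exp (-c₀ * (‖x - y‖ ^ (2 - a) / t) ^ (1 / (1 - a)))) :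
    ∃ δ : ℝ, 0 < δ ∧ ∀ φ : E N → ℝ, Measurable φ →
      (∀ x : E N, 0 ≤ φ x ∧ φ x ≤ δ / (1 + ‖x‖ ^ ((2 - a) / (p - 1)))) →
      ∃ u : E N → ℝ → ℝ, IsMildSolution N p Γ φ ⊤ u ∧
        (∀ q : ℝ, rs ≤ q → ∃ C : ℝ≥0∞, C ≠ ⊤ ∧ ∀ t : ℝ, 0 < t →
          ENNReal.ofReal ((1 + t) ^ ((N : ℝ) / (2 - a) * (1 / rs - 1 / q))) *
            weakNorm N q (fun x => u x t) ≤ C) ∧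
        (∃ C : ℝ≥0∞, C ≠ ⊤ ∧ ∀ t : ℝ, 0 < t →
          ENNReal.ofReal ((1 + t) ^ ((N : ℝ) / (2 - a) * (1 / rs))) *
            eLpNorm (fun x => u x t) ⊤ volume ≤ C) := by
  obtain ⟨C₀, c₀, hC₀, hc₀, hup⟩ := hupp
  have hN0 : (0 : ℝ) < N := by exact_mod_cast hN
  set β : ℝ := 2 - a with hβdef
  have hβ : 0 < β := by linarith
  have hp1 : 0 < p - 1 := by have : 0 < β / N := by positivity
                             linarith
  have hrs1 : 1 < rs := by
    have h : β / N < p - 1 := by linarith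
    rw [div_lt_iff₀ hN0] at h
    rw [hrs, one_lt_div hβ]
    linarith
  have hrs0 : 0 < rs := by linarith
  obtain ⟨r, hr1, hr⟩ := exists_between (lt_min (show 1 < p by linarith) hrs1)
  obtain ⟨hrp, hrrs⟩ := lt_min_iff.1 hr
  have hr0 : 0 < r := by linarith
  set γ : ℝ := β / (p - 1) with hγdef
  have hγ : 0 < γ := by positivity
  have hNγ : rs = N / γ := by rw [hrs, hγdef]; field_simp
  have hm : 0 < r * γ := by positivity
  have hmN : r * γ < N := by
    rw [hNγ, lt_div_iff₀ hγ] at hrrs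
    exact hrrs
  -- the kernel in extended nonnegative reals
  set K : E N → E N → ℝ → ℝ≥0∞ := fun x y t => ENNReal.ofReal (Γ x y t) with hKdef
  have hK : Measurable (fun q : E N × E N × ℝ => K q.1 q.2.1 q.2.2) := hΓmeas.ennreal_ofReal
  have hint_x : ∀ y, ∀ t : ℝ, 0 < t → Integrable fun x => Γ x y t := fun y t ht =>
    Integrable.of_integral_ne_zero (by rw [hK1x y t ht]; exact one_ne_zero)
  have hint_y : ∀ x, ∀ t : ℝ, 0 < t → Integrable fun y => Γ x y t := fun x t ht =>
    Integrable.of_integral_ne_zero (by rw [hK1y x t ht]; exact one_ne_zero)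
  have hK1 : ∀ x, ∀ t : ℝ, 0 < t → ∫⁻ y, K x y t = 1 := by
    intro x t ht
    rw [← ofReal_integral_eq_lintegral_ofReal (hint_y x t ht)
      (.of_forall fun y => hΓnonneg x y t ht), hK1y x t ht, ENNReal.ofReal_one]
  have hK1' : ∀ y, ∀ t : ℝ, 0 < t → ∫⁻ x, K x y t = 1 := by
    intro y t ht
    rw [← ofReal_integral_eq_lintegral_ofReal (hint_x y t ht)
      (.of_forall fun x => hΓnonneg x y t ht), hK1x y t ht, ENNReal.ofReal_one]
  have hΓsup : ∀ x y, ∀ t : ℝ, 0 < t → Γ x y t ≤ C₀ * t ^ (-(N : ℝ) / β) := by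
    intro x y t ht
    refine (hup x y t ht).trans (mul_le_of_le_one_right (by positivity) ?_)
    rw [Real.exp_le_one_iff, neg_mul, neg_nonpos]
    positivity
  have hsup : ∀ x y, ∀ t : ℝ, 0 < t → K x y t ≤ ENNReal.ofReal (C₀ * t ^ (-(N : ℝ) / β)) :=
    fun x y t ht => ENNReal.ofReal_le_ofReal (hΓsup x y t ht)
  have hKK : ∀ x y, ∀ s t : ℝ, 0 < s → s < t → K x y t = ∫⁻ ξ, K x ξ (t - s) * K ξ y s := by
    intro x y s t hs hst
    have hts : 0 < t - s := sub_pos.2 hst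
    have hmeas : Measurable fun ξ => Γ x ξ (t - s) :=
      hΓmeas.comp (by fun_prop : Measurable fun ξ : E N => (x, ξ, t - s))
    have hint : Integrable fun ξ => Γ x ξ (t - s) * Γ ξ y s :=
      (hint_x y s hs).bdd_mul hmeas.aestronglyMeasurable (.of_forall fun ξ => by
        rw [Real.norm_of_nonneg (hΓnonneg _ _ _ hts)]
        exact hΓsup x ξ _ hts)
    simp only [hKdef]
    rw [hK2 x y s t hs hst, ofReal_integral_eq_lintegral_ofReal hint
      (.of_forall fun ξ => mul_nonneg (hΓnonneg _ _ _ hts) (hΓnonneg _ _ _ hs))]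
    exact lintegral_congr fun ξ => ENNReal.ofReal_mul (hΓnonneg _ _ _ hts)
  -- the weight and its `r`-th power
  set w : E N → ℝ≥0∞ := fun y => ENNReal.ofReal ((1 + ‖y‖ ^ γ)⁻¹) with hw
  have hwm : Measurable w := by
    refine Measurable.ennreal_ofReal ?_
    fun_prop
  set ψ : E N → ℝ≥0∞ := fun y => w y ^ r with hψ
  have hψm : Measurable ψ := hwm.pow_const r
  have hψ₀ : ∀ y, ψ y ≤ 1 := by
    intro y
    have : w y ≤ 1 := by
      rw [hw, ENNReal.ofReal_le_one]
      refine inv_le_one_of_one_le₀ ?_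
      have : 0 ≤ ‖y‖ ^ γ := by positivity
      linarith
    exact (ENNReal.rpow_le_rpow this hr0.le).trans_eq (ENNReal.one_rpow r)
  have hψ₁ : ∀ R : ℝ, 0 < R → ∀ y : E N, R ≤ ‖y‖ → ψ y ≤ ENNReal.ofReal (R ^ (-(r * γ))) := by
    intro R hR y hy
    have : w y ≤ ENNReal.ofReal (R ^ (-γ)) := by
      refine ENNReal.ofReal_le_ofReal ?_
      rw [Real.rpow_neg hR.le]
      have h1 : R ^ γ ≤ ‖y‖ ^ γ := Real.rpow_le_rpow hR.le hy hγ.le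
      exact inv_anti₀ (by positivity) (by linarith)
    refine (ENNReal.rpow_le_rpow this hr0.le).trans_eq ?_
    rw [ENNReal.ofReal_rpow_of_nonneg (by positivity) hr0.le, ← Real.rpow_mul hR.le]
    congr 2
    ring
  have : Nonempty (Fin N) := ⟨⟨0, hN⟩⟩
  obtain ⟨C, hC, hball⟩ := setLIntegral_ball_norm_rpow_le hN hmN
  have hψ₂ : ∀ R : ℝ, 0 < R → ∫⁻ y in Metric.ball (0 : E N) R, ψ y
      ≤ ENNReal.ofReal (C * R ^ ((N : ℝ) - r * γ)) := by
    intro R hR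
    refine (lintegral_mono_ae (ae_restrict_of_ae ?_)).trans (hball R hR)
    filter_upwards [Measure.ae_ne volume (0 : E N)] with y hy
    exact hψ₁ _ (norm_pos_iff.2 hy) y le_rfl
  obtain ⟨B, hB, hdecay⟩ := exists_kernelOp_le_rpow hK1 hK hβ hC₀ hsup hm hC hψ₀ hψ₁ hψ₂
  have hrate : r * γ / β = r / (p - 1) := by rw [hγdef]; field_simp
  rw [hrate] at hdecay
  obtain ⟨δ, hδ, hsuper⟩ := exists_supersolution hK hK1 hKK hr1 hrp hB hwm hdecay
  refine ⟨δ, hδ, fun φ hφm hφ => ?_⟩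
  have hφw : ∀ x, ENNReal.ofReal (φ x) ≤ ENNReal.ofReal δ * w x := by
    intro x
    rw [hw, ← ENNReal.ofReal_mul hδ.le, ← div_eq_mul_inv]
    exact ENNReal.ofReal_le_ofReal (hφ x).2
  obtain ⟨u, hum, hule, hfix⟩ := exists_duhamelMap_fixedPoint hK (by linarith : 0 < p)
    hφm.ennreal_ofReal (hsuper _ hφw)
  -- pointwise decay of the solution
  set k : ℝ := 1 / (p - 1) with hk
  have hk0 : 0 < k := by positivity
  set M : ℝ := 2 * δ * B ^ (1 / r) with hM
  have hM0 : 0 < M := by positivity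
  have hubound : ∀ x, ∀ t : ℝ, 0 < t → u x t ≤ ENNReal.ofReal (M * (1 + t) ^ (-k)) := by
    intro x t ht
    refine (hule x t ht).trans ?_
    have h := ENNReal.rpow_le_rpow (hdecay x t ht) (show 0 ≤ 1 / r by positivity)
    refine (mul_le_mul_right h _).trans_eq ?_
    rw [ENNReal.ofReal_rpow_of_nonneg (by positivity) (by positivity),
      ← ENNReal.ofReal_mul (by positivity), Real.mul_rpow hB.le (by positivity),
      ← Real.rpow_mul (by positivity), hM, mul_assoc (2 * δ)]
    congr 4
    rw [hk]
    field_simp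
  have hvbound : ∀ x, ∀ t : ℝ, 0 < t → |(u x t).toReal| ≤ M * (1 + t) ^ (-k) := by
    intro x t ht
    rw [abs_of_nonneg ENNReal.toReal_nonneg]
    exact ENNReal.toReal_le_of_le_ofReal (by positivity) (hubound x t ht)
  have hvM : ∀ x, ∀ t : ℝ, 0 < t → u x t ≤ ENNReal.ofReal M := by
    intro x t ht
    refine (hubound x t ht).trans (ENNReal.ofReal_le_ofReal
      (mul_le_of_le_one_right hM0.le ?_))
    exact Real.rpow_le_one_of_one_le_of_nonpos (by linarith) (by linarith)
  -- weak-type bound at the scaling-critical exponent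
  have hweak : ∀ t l : ℝ, 0 < t → 0 < l → volume {x | l < |(u x t).toReal|}
      ≤ ENNReal.ofReal (C * ((2 * δ) ^ r * 2) ^ (N / (r * γ)) * l ^ (-rs)) := by
    intro t l ht hl
    set R : ℝ := ((l / (2 * δ)) ^ r / 2) ^ (-(1 / (r * γ))) with hR
    have hR0 : 0 < R := by positivity
    have hRm : 2 * R ^ (-(r * γ)) = (l / (2 * δ)) ^ r := by
      have : -(1 / (r * γ)) * -(r * γ) = 1 := by field_simp
      rw [hR, ← Real.rpow_mul (by positivity), this, Real.rpow_one]
      ring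
    refine (measure_mono fun x hx => ?_).trans
      ((volume_lt_kernelOp_le hK1 hK1' hK hψm hψ₁ hψ₂ hR0 ht).trans_eq ?_)
    · simp only [mem_ofPred_eq, abs_of_nonneg ENNReal.toReal_nonneg] at hx ⊢
      rw [hRm]
      by_contra! hV
      refine absurd hx (not_lt.2 (ENNReal.toReal_le_of_le_ofReal hl.le ((hule x t ht).trans ?_)))
      have h := ENNReal.rpow_le_rpow hV (show 0 ≤ 1 / r by positivity)
      refine (mul_le_mul_right h _).trans_eq ?_
      rw [ENNReal.ofReal_rpow_of_nonneg (by positivity) (by positivity),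
        ← ENNReal.ofReal_mul (by positivity), ← Real.rpow_mul (by positivity),
        mul_one_div_cancel hr0.ne', Real.rpow_one]
      congr 1
      field_simp
    · congr 1
      rw [mul_assoc]
      congr 1
      have e1 : (l / (2 * δ)) ^ r / 2 = ((2 * δ) ^ r * 2)⁻¹ * l ^ r := by
        rw [Real.div_rpow hl.le (by positivity)]
        field_simp
      have e2 : -(1 / (r * γ)) * N = -(N / (r * γ)) := by ring
      have e3 : r * -(N / (r * γ)) = -rs := by rw [hNγ]; field_simp
      rw [hR, ← Real.rpow_mul (by positivity), e1, e2,
        Real.mul_rpow (by positivity) (by positivity), ← Real.rpow_mul hl.le, e3,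
        Real.inv_rpow (by positivity), Real.rpow_neg (by positivity), inv_inv]
  have hkrs : (N : ℝ) / β * (1 / rs) = k := by rw [hk, hrs]; field_simp
  refine ⟨fun x t => (u x t).toReal,
    isMildSolution_toReal (by linarith) hΓmeas hΓnonneg hφm (fun x => (hφ x).1) hum hM0.le hvM hfix,
    fun q hq => ?_, ?_⟩
  · obtain ⟨C', hC', h⟩ := exists_weakNorm_le (v := fun x t => (u x t).toReal) hM0
      (by positivity) hrs0 hvbound hweak hq
    refine ⟨C', hC', fun t ht => ?_⟩
    have hq0 : 0 < q := by linarith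
    have e : (N : ℝ) / β * (1 / rs - 1 / q) = k * (1 - rs / q) := by
      rw [← hkrs]
      field_simp
    rw [e]
    exact h t ht
  · refine ⟨ENNReal.ofReal M, ENNReal.ofReal_ne_top, fun t ht => ?_⟩
    have h : eLpNorm (fun x => (u x t).toReal) ⊤ volume ≤ ENNReal.ofReal (M * (1 + t) ^ (-k)) := by
      refine (eLpNorm_le_of_ae_bound (C := M * (1 + t) ^ (-k))
        (.of_forall fun x => hvbound x t ht)).trans_eq ?_
      simp
    rw [hkrs]
    refine (mul_le_mul_right h _).trans_eq ?_
    rw [← ENNReal.ofReal_mul (by positivity)]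
    congr 1
    rw [mul_left_comm, ← Real.rpow_add (by positivity)]
    simp
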